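/- Let H be a countable right-orderable group, let f ∈ H with f ≠ 1, let a < b be real numbers with I = (a, b) the open interval, and let x, y ∈ I with x < y. Then there exist injective group homomorphisms ν₁ and ν₂ from H to the group of order-preserving bijections of I (written as right actions) such that y < x·ν₁(f) and y·ν₂(f) < x. -/

import Mathlib

/-- A group is right-orderable if there is a strict total order on it invariant
under right multiplication. -/
def IsRightOrderable (H : Type*) [Group H] : Prop :=
  ∃ lt : H → H → Prop, IsStrictTotalOrder H lt ∧ ∀ f g h : H, lt f g → lt (f * h) (g * h)

/-- A right action of `H` on the open interval `I = (a, b)` by orientation-preserving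
homeomorphisms: a map to order-preserving bijections of `I` with
`x·ν(gh) = (x·ν(g))·ν(h)`. -/
def IsIntervalRightAction {H : Type*} [Group H] {a b : ℝ}
    (ν : H → (Set.Ioo a b ≃o Set.Ioo a b)) : Prop :=
  ∀ g h : H, ν (g * h) = (ν g).trans (ν h)

open Set

/-- The extension to the real line of an order automorphism of the rationals. -/
noncomputable def ratExtend (φ : ℚ ≃o ℚ) (x : ℝ) : ℝ :=
  sSup ((fun q : ℚ => ((φ q : ℚ) : ℝ)) '' {q : ℚ | (q : ℝ) < x})

theorem ratCast_lt_ratExtend (φ : ℚ ≃o ℚ) (q : ℚ) (x : ℝ) :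
    (q : ℝ) < ratExtend φ x ↔ ((φ.symm q : ℚ) : ℝ) < x := by
  obtain ⟨u, hu⟩ := exists_rat_gt x
  obtain ⟨l, hl⟩ := exists_rat_lt x
  have hbdd : BddAbove ((fun q : ℚ => ((φ q : ℚ) : ℝ)) '' {q : ℚ | (q : ℝ) < x}) := by
    refine ⟨(φ u : ℝ), ?_⟩
    rintro _ ⟨r, hr, rfl⟩
    have hru : r < u := by exact_mod_cast lt_trans hr hu
    exact Rat.cast_le.2 (φ.strictMono hru).le
  unfold ratExtend
  rw [lt_csSup_iff hbdd ⟨_, l, hl, rfl⟩]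
  constructor
  · rintro ⟨_, ⟨r, hr, rfl⟩, hqr⟩
    have hqr' : q < φ r := Rat.cast_lt.1 hqr
    have hlt : φ.symm q < r := φ.symm_apply_lt.2 hqr'
    exact lt_trans (by exact_mod_cast hlt) hr
  · intro h
    obtain ⟨r, hqr, hrx⟩ := exists_rat_btwn h
    have hlt : φ.symm q < r := by exact_mod_cast hqr
    exact ⟨_, ⟨r, hrx, rfl⟩, Rat.cast_lt.2 (φ.symm_apply_lt.1 hlt)⟩

theorem eq_of_forall_ratCast_lt_iff {x y : ℝ} (h : ∀ q : ℚ, (q : ℝ) < x ↔ (q : ℝ) < y) :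
    x = y :=
  le_antisymm (le_of_forall_rat_lt_imp_le fun q hq => ((h q).1 hq).le)
    (le_of_forall_rat_lt_imp_le fun q hq => ((h q).2 hq).le)

theorem ratExtend_refl (x : ℝ) : ratExtend (OrderIso.refl ℚ) x = x :=
  eq_of_forall_ratCast_lt_iff fun q => by simp [ratCast_lt_ratExtend]

theorem ratExtend_trans (φ ψ : ℚ ≃o ℚ) (x : ℝ) :
    ratExtend (φ.trans ψ) x = ratExtend ψ (ratExtend φ x) :=
  eq_of_forall_ratCast_lt_iff fun q => by simp [ratCast_lt_ratExtend]

theorem ratExtend_ratCast (φ : ℚ ≃o ℚ) (r : ℚ) : ratExtend φ r = (φ r : ℚ) :=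
  eq_of_forall_ratCast_lt_iff fun q => by
    rw [ratCast_lt_ratExtend]
    exact_mod_cast φ.symm_apply_lt

theorem monotone_ratExtend (φ : ℚ ≃o ℚ) : Monotone (ratExtend φ) := fun x y hxy =>
  le_of_forall_rat_lt_imp_le fun q hq => by
    rw [ratCast_lt_ratExtend] at hq
    exact ((ratCast_lt_ratExtend φ q y).2 (hq.trans_le hxy)).le

/-- The order automorphism of the real line extending an order automorphism of the rationals. -/
noncomputable def ratExtendIso (φ : ℚ ≃o ℚ) : ℝ ≃o ℝ :=
  Equiv.toOrderIso
    { toFun := ratExtend φ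
      invFun := ratExtend φ.symm
      left_inv := fun x => by
        rw [← ratExtend_trans, OrderIso.self_trans_symm, ratExtend_refl]
      right_inv := fun x => by
        rw [← ratExtend_trans, OrderIso.symm_trans_self, ratExtend_refl] }
    (monotone_ratExtend φ) (monotone_ratExtend φ.symm)

theorem ratExtendIso_apply (φ : ℚ ≃o ℚ) (x : ℝ) : ratExtendIso φ x = ratExtend φ x := rfl

/-- A countable right-ordered group acts on the right on the real line in such a way that
its order is the order of some orbit. -/
theorem exists_real_action_orbit_lt_iff (H : Type*) [Group H] [Countable H] [LinearOrder H]
    [MulRightMono H] :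
    ∃ (ν : H → (ℝ ≃o ℝ)) (p : ℝ), (∀ g h, ν (g * h) = (ν g).trans (ν h)) ∧
      ∀ g h, ν g p < ν h p ↔ g < h := by
  have : Countable (H ×ₗ ℚ) := inferInstanceAs (Countable (H × ℚ))
  have : Nonempty (H ×ₗ ℚ) := ⟨toLex (1, 0)⟩
  obtain ⟨e⟩ := Order.iso_of_countable_dense (H ×ₗ ℚ) ℚ
  let act : H → (H ×ₗ ℚ ≃o H ×ₗ ℚ) := fun g =>
    Prod.Lex.prodLexCongr (OrderIso.mulRight g) (OrderIso.refl ℚ)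
  have hact : ∀ g h, act (g * h) = (act g).trans (act h) := fun g h =>
    OrderIso.ext (funext fun z => by
      simp [act, Prod.map, mul_assoc])
  have hone : ∀ g, act g (toLex (1, 0)) = toLex (g, 0) := fun g => by simp [act]
  refine ⟨fun g => ratExtendIso ((e.symm.trans (act g)).trans e), (e (toLex (1, 0)) : ℚ), ?_, ?_⟩
  · intro g h
    refine OrderIso.ext (funext fun z => ?_)
    simp only [OrderIso.trans_apply, ratExtendIso_apply, ← ratExtend_trans]
    congr 1
    refine OrderIso.ext (funext fun q => ?_)
    simp [hact]
  · intro g h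
    simp [ratExtendIso_apply, ratExtend_ratCast, hone, Prod.Lex.toLex_lt_toLex]

theorem exists_real_orderIso_of_lt {p q u v : ℝ} (hpq : p < q) (huv : u < v) :
    ∃ L : ℝ ≃o ℝ, L p = u ∧ L q = v := by
  have hc : 0 < (v - u) / (q - p) := div_pos (sub_pos.2 huv) (sub_pos.2 hpq)
  refine ⟨((OrderIso.addRight (-p)).trans (OrderIso.mulRight₀ _ hc)).trans
    (OrderIso.addRight u), ?_, ?_⟩
  · simp
  · have : q - p ≠ 0 := (sub_pos.2 hpq).ne'
    simp [← sub_eq_add_neg]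
    field_simp
    ring

theorem nonempty_real_orderIso_Ioo {a b : ℝ} (hab : a < b) : Nonempty (ℝ ≃o Ioo a b) := by
  obtain ⟨L, ha, hb⟩ := exists_real_orderIso_of_lt (show (-1 : ℝ) < 1 by norm_num) hab
  have hmem : ∀ t, t ∈ Ioo (-1 : ℝ) 1 ↔ L.toEquiv t ∈ Ioo a b := fun t => by
    simp [← ha, ← hb]
  exact ⟨(orderIsoIooNegOneOne ℝ).trans
    { toEquiv := L.toEquiv.subtypeEquiv hmem
      map_rel_iff' := fun {s t} => L.le_iff_le (x := s.1) (y := t.1) }⟩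

/-- Transport of a right action on the real line to an interval. -/
theorem isIntervalRightAction_conj {H : Type*} [Group H] {a b : ℝ} {ν : H → (ℝ ≃o ℝ)}
    (hν : ∀ g h, ν (g * h) = (ν g).trans (ν h)) (e : ℝ ≃o Ioo a b) :
    IsIntervalRightAction fun g => (e.symm.trans (ν g)).trans e := fun g h =>
  OrderIso.ext (funext fun z => by simp [hν])

/-- A countable right-ordered group acts faithfully on the right on an open interval so that
an element `f > 1` moves the first of two given points past the second one, and an element
`f < 1` moves the second point past the first one. -/
theorem exists_faithful_action_of_linearOrder (H : Type*) [Group H] [Countable H] [LinearOrder H]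
    [MulRightMono H] {f : H} {a b : ℝ} (hab : a < b) {x y : Ioo a b} (hxy : x < y) :
    (1 < f → ∃ ν : H → (Ioo a b ≃o Ioo a b),
      IsIntervalRightAction ν ∧ Function.Injective ν ∧ y < ν f x) ∧
    (f < 1 → ∃ ν : H → (Ioo a b ≃o Ioo a b),
      IsIntervalRightAction ν ∧ Function.Injective ν ∧ ν f y < x) := by
  obtain ⟨ν, p, hmul, hlt⟩ := exists_real_action_orbit_lt_iff H
  obtain ⟨e⟩ := nonempty_real_orderIso_Ioo hab
  have hp : ν 1 p = p := by
    have h := hmul 1 1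
    rw [mul_one] at h
    exact (ν 1).injective (DFunLike.congr_fun h p).symm
  have hinj : ∀ d : ℝ ≃o Ioo a b,
      Function.Injective fun g => (d.symm.trans (ν g)).trans d := by
    intro d g h hgh
    have hgp : ν g p = ν h p := by
      simpa using DFunLike.congr_fun hgh (d p)
    exact le_antisymm (not_lt.1 fun hl => ((hlt h g).2 hl).ne' hgp)
      (not_lt.1 fun hl => ((hlt g h).2 hl).ne hgp)
  have hxy' : e.symm x < e.symm y := e.symm.strictMono hxy
  constructor
  · intro hf
    have hpf : p < ν f p := by simpa [hp] using (hlt 1 f).2 hf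
    obtain ⟨L, hLp, hLq⟩ := exists_real_orderIso_of_lt hpf
      (hxy'.trans (lt_add_one (e.symm y)))
    refine ⟨_, isIntervalRightAction_conj hmul (L.trans e), hinj _, ?_⟩
    have hx : (L.trans e).symm x = p := by simp [← hLp]
    simp only [OrderIso.trans_apply, hx, hLq]
    exact e.symm_apply_lt.1 (lt_add_one _)
  · intro hf
    have hpf : ν f p < p := by simpa [hp] using (hlt f 1).2 hf
    obtain ⟨L, hLq, hLp⟩ := exists_real_orderIso_of_lt hpf
      ((sub_one_lt (e.symm x)).trans hxy')
    refine ⟨_, isIntervalRightAction_conj hmul (L.trans e), hinj _, ?_⟩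
    have hy : (L.trans e).symm y = p := by simp [← hLp]
    simp only [OrderIso.trans_apply, hy, hLq]
    exact e.lt_symm_apply.1 (sub_one_lt _)

/-- A right-orderable group has a right-invariant linear order in which a given nontrivial element
is positive, and one in which it is negative. -/
theorem IsRightOrderable.exists_linearOrder {H : Type*} [Group H] (hH : IsRightOrderable H)
    {f : H} (hf : f ≠ 1) :
    (∃ _ : LinearOrder H, MulRightMono H ∧ 1 < f) ∧
      (∃ _ : LinearOrder H, MulRightMono H ∧ f < 1) := by
  classical
  have order : ∀ lt : H → H → Prop, IsStrictTotalOrder H lt →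
      (∀ f g h : H, lt f g → lt (f * h) (g * h)) →
      ∃ o : LinearOrder H, MulRightMono H ∧ ∀ g h : H, o.lt g h ↔ lt g h := by
    intro lt hlt hmul
    let : LinearOrder H := linearOrderOfSTO lt
    refine ⟨inferInstance, ⟨fun h f g hfg => ?_⟩, fun _ _ => Iff.rfl⟩
    rcases hfg.eq_or_lt with rfl | hfg
    · exact le_rfl
    · exact le_of_lt (hmul f g h hfg)
  obtain ⟨lt, hlt, hmul⟩ := hH
  obtain ⟨o, hm, ho⟩ := order lt hlt hmul
  obtain ⟨o', hm', ho'⟩ := order (Function.swap lt) inferInstance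
    fun f g h => hmul g f h
  rcases trichotomous_of lt 1 f with h | h | h
  · exact ⟨⟨o, hm, (ho _ _).2 h⟩, o', hm', (ho' _ _).2 h⟩
  · exact absurd h.symm hf
  · exact ⟨⟨o', hm', (ho' _ _).2 h⟩, o, hm, (ho _ _).2 h⟩

/-- Given a nontrivial element `f` of a countable right-orderable group `H`, an open
interval `I = (a, b)` and points `x < y` in `I`, there are faithful right actions
`ν₁, ν₂` of `H` on `I` with `y < x·ν₁(f)` and `y·ν₂(f) < x`. -/
theorem exists_faithful_action_moving_point
    {H : Type*} [Group H] [Countable H] (hH : IsRightOrderable H)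
    (f : H) (hf : f ≠ 1) {a b : ℝ} (hab : a < b)
    {x y : ℝ} (hx : x ∈ Set.Ioo a b) (hy : y ∈ Set.Ioo a b) (hxy : x < y) :
    ∃ ν₁ ν₂ : H → (Set.Ioo a b ≃o Set.Ioo a b),
      IsIntervalRightAction ν₁ ∧ Function.Injective ν₁ ∧
      IsIntervalRightAction ν₂ ∧ Function.Injective ν₂ ∧
      y < (ν₁ f ⟨x, hx⟩ : ℝ) ∧ (ν₂ f ⟨y, hy⟩ : ℝ) < x := by
  obtain ⟨⟨o₁, hm₁, h₁⟩, o₂, hm₂, h₂⟩ := hH.exists_linearOrder hf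
  have hlt : (⟨x, hx⟩ : Set.Ioo a b) < ⟨y, hy⟩ := hxy
  obtain ⟨ν₁, hν₁, hi₁, hy₁⟩ :=
    (@exists_faithful_action_of_linearOrder H _ _ o₁ hm₁ _ _ _ hab _ _ hlt).1 h₁
  obtain ⟨ν₂, hν₂, hi₂, hx₂⟩ :=
    (@exists_faithful_action_of_linearOrder H _ _ o₂ hm₂ _ _ _ hab _ _ hlt).2 h₂
  exact ⟨ν₁, ν₂, hν₁, hi₁, hν₂, hi₂, hy₁, hx₂⟩
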